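/- Fix real numbers b and c. Let C be a family assigning to each genus g ∈ ℕ, each number of vertices v ≥ 1, and each degree vector (μ₁,…,μ_v) ∈ ℕ^v a real number C_{g,v}(μ₁,…,μ_v), and assume C satisfies the generalized Catalan recursion: for all g ∈ ℕ, v ≥ 1, and (μ₁,…,μ_v) with μ₁ ≥ 1, C_{g,v}(μ₁,…,μ_v) = Σ_{j=2}^{v} μ_j · C_{g,v-1}(μ₁+μ_j−2, μ₂,…,μ̂_j,…,μ_v) + Σ_{α+β=μ₁−2} [ C_{g−1,v+1}(α,β,μ₂,…,μ_v) + Σ_{g₁+g₂=g} Σ_{I⊔J={2,…,v}} C_{g₁,|I|+1}(α,μ_I)·C_{g₂,|J|+1}(β,μ_J) ], where the sum over α+β=μ₁−2 ranges over nonnegative integers (hence is empty when μ₁ < 2), terms with genus −1 are interpreted as 0, and the last sum is over all decompositions g₁+g₂=g and all ordered set partitions I⊔J of {2,…,v}. Define the generalized bc-Motzkin numbers by M̃_{g,v}(n₁,…,n_v;b,c) = Σ_{μ₁=0}^{n₁} ⋯ Σ_{μ_v=0}^{n_v} binom(n₁,μ₁)⋯binom(n_v,μ_v) · C_{g,v}(μ₁,…,μ_v)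 · b^{(n₁+⋯+n_v)−(μ₁+⋯+μ_v)} · c^{μ₁+⋯+μ_v}. Then for all g ∈ ℕ, v ≥ 1, and (n₁,…,n_v) ∈ ℕ^v with n₁ ≥ 1: M̃_{g,v}(n₁,…,n_v;b,c) − b·M̃_{g,v}(n₁−1,n₂,…,n_v;b,c) = c²·[ Σ_{j=2}^{v} n_j · M̃_{g,v−1}(n₁+n_j−2, n₂,…,n̂_j,…,n_v;b,c) + Σ_{ζ+ξ=n₁−2} ( M̃_{g−1,v+1}(ζ,ξ,n₂,…,n_v;b,c) + Σ_{g₁+g₂=g} Σ_{I⊔J={2,…,v}} M̃_{g₁,|I|+1}(ζ,n_I;b,c)·M̃_{g₂,|J|+1}(ξ,n_J;b,c) ) ], with the same conventions on empty sums and genus −1 terms. -/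

import Mathlib

open Finset

/-- Delete the `j`-th entry of a vector of length `m`, yielding a vector of
length `m - 1`. -/
def deleteAt {m : ℕ} (j : Fin m) (f : Fin m → ℕ) : Fin (m - 1) → ℕ :=
  fun i =>
    if h : (i : ℕ) < (j : ℕ) then f ⟨(i : ℕ), lt_trans h j.isLt⟩
    else f ⟨(i : ℕ) + 1, by have := i.isLt; omega⟩

/-- The subvector of `f` indexed by the finite set `I`, listed in increasing
index order. -/
def subvec {m : ℕ} (f : Fin m → ℕ) (I : Finset (Fin m)) : Fin I.card → ℕ :=
  fun i => f (I.orderEmbOfFin rfl i)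

/-- The generalized `bc`-Motzkin numbers built from a family `C` (of generalized
Catalan numbers):
`M̃_{g,v}(n₁,…,n_v;b,c) = ∑_{μ₁=0}^{n₁} ⋯ ∑_{μ_v=0}^{n_v} binom(n₁,μ₁)⋯binom(n_v,μ_v) ·
  C_{g,v}(μ₁,…,μ_v) · b^{(n₁+⋯+n_v)−(μ₁+⋯+μ_v)} · c^{μ₁+⋯+μ_v}`. -/
noncomputable def Mgen (b c : ℝ) (C : ℕ → (v : ℕ) → (Fin v → ℕ) → ℝ)
    (g : ℕ) (v : ℕ) (n : Fin v → ℕ) : ℝ :=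
  ∑ μ ∈ Fintype.piFinset (fun i => Finset.range (n i + 1)),
    (∏ i, (Nat.choose (n i) (μ i) : ℝ)) * C g v μ *
      b ^ ((∑ i, n i) - (∑ i, μ i)) * c ^ (∑ i, μ i)

/-- One-variable weight. -/
noncomputable def bcW (b c : ℝ) (n k : ℕ) : ℝ := (n.choose k : ℝ) * b ^ (n - k) * c ^ k

/-- One-variable binomial transform. -/
noncomputable def bcB (b c : ℝ) (n : ℕ) (f : ℕ → ℝ) : ℝ :=
  ∑ k ∈ Finset.range (n + 1), bcW b c n k * f k

/-- Multivariable binomial transform. -/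
noncomputable def bcT (b c : ℝ) {ι : Type} [Fintype ι] [DecidableEq ι] (n : ι → ℕ)
    (f : (ι → ℕ) → ℝ) : ℝ :=
  ∑ μ ∈ Fintype.piFinset (fun i => Finset.range (n i + 1)), (∏ i, bcW b c (n i) (μ i)) * f μ

theorem Mgen_eq_bcT (b c : ℝ) (C : ℕ → (v : ℕ) → (Fin v → ℕ) → ℝ) (g v : ℕ) (n : Fin v → ℕ) :
    Mgen b c C g v n = bcT b c n (C g v) := by
  unfold Mgen bcT
  refine Finset.sum_congr rfl fun μ hμ => ?_
  have hle : ∀ i, μ i ≤ n i := fun i => by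
    have := Fintype.mem_piFinset.1 hμ i
    simp at this; omega
  have h1 : (∑ i, n i) - (∑ i, μ i) = ∑ i, (n i - μ i) := by
    rw [Finset.sum_tsub_distrib _ (fun i _ => hle i)]
  unfold bcW
  rw [h1, Finset.prod_mul_distrib, Finset.prod_mul_distrib, Finset.prod_pow_eq_pow_sum,
    Finset.prod_pow_eq_pow_sum]
  ring

theorem bcB_zero (b c : ℝ) (f : ℕ → ℝ) : bcB b c 0 f = f 0 := by
  simp [bcB, bcW]

theorem bcB_add (b c : ℝ) (n : ℕ) (f h : ℕ → ℝ) :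
    bcB b c n (fun k => f k + h k) = bcB b c n f + bcB b c n h := by
  simp [bcB, mul_add, Finset.sum_add_distrib]

theorem bcB_smul (b c : ℝ) (n : ℕ) (a : ℝ) (f : ℕ → ℝ) :
    bcB b c n (fun k => a * f k) = a * bcB b c n f := by
  simp only [bcB, Finset.mul_sum]
  exact Finset.sum_congr rfl fun _ _ => by ring

theorem bcB_sum (b c : ℝ) {κ : Type} (n : ℕ) (s : Finset κ) (f : κ → ℕ → ℝ) :
    bcB b c n (fun k => ∑ x ∈ s, f x k) = ∑ x ∈ s, bcB b c n (f x) := by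
  simp only [bcB, Finset.mul_sum]
  exact Finset.sum_comm

theorem bcB_succ (b c : ℝ) (n : ℕ) (f : ℕ → ℝ) :
    bcB b c (n + 1) f = b * bcB b c n f + c * bcB b c n (fun k => f (k + 1)) := by
  have h2 : b * bcB b c n f = ∑ k ∈ Finset.range (n + 1 + 1),
      (n.choose k : ℝ) * b ^ (n + 1 - k) * c ^ k * f k := by
    rw [Finset.sum_range_succ _ (n + 1)]
    simp only [bcB, bcW, Nat.choose_succ_self, Finset.mul_sum]
    simp only [Nat.cast_zero, zero_mul, add_zero]
    refine Finset.sum_congr rfl fun k hk => ?_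
    have : n + 1 - k = (n - k) + 1 := by simp at hk; omega
    rw [this]; ring
  rw [h2, Finset.sum_range_succ' _ (n + 1)]
  unfold bcB
  rw [Finset.sum_range_succ' _ (n + 1), Finset.mul_sum]
  have : ∀ k ∈ Finset.range (n + 1), bcW b c (n + 1) (k + 1) * f (k + 1) =
      (n.choose (k + 1) : ℝ) * b ^ (n + 1 - (k + 1)) * c ^ (k + 1) * f (k + 1) +
      c * (bcW b c n k * f (k + 1)) := by
    intro k _
    simp only [bcW, Nat.choose_succ_succ, Nat.add_sub_add_right]
    push_cast; ring
  rw [Finset.sum_congr rfl this, Finset.sum_add_distrib]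
  simp [bcW]
  ring

theorem bcB_vandermonde (b c : ℝ) (N n : ℕ) (f : ℕ → ℝ) :
    bcB b c N (fun k => bcB b c n (fun l => f (k + l))) = bcB b c (N + n) f := by
  induction N generalizing f with
  | zero => simp [bcB_zero]
  | succ N ih =>
    rw [bcB_succ, ih, show N + 1 + n = (N + n) + 1 by ring, bcB_succ,
      ← ih (fun k => f (k + 1))]
    simp only [show ∀ k l : ℕ, k + 1 + l = k + l + 1 by intros; ring]

theorem bcB_deriv (b c : ℝ) (n : ℕ) (f : ℕ → ℝ) :
    bcB b c n (fun l => (l : ℝ) * f (l - 1)) = n * c * bcB b c (n - 1) f := by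
  induction n generalizing f with
  | zero => simp [bcB_zero]
  | succ n ih =>
    rw [bcB_succ, ih]
    have h : (fun k : ℕ => ((k + 1 : ℕ) : ℝ) * f (k + 1 - 1)) =
        fun k : ℕ => (k : ℝ) * (fun s => f (s + 1)) (k - 1) + f k := by
      funext k
      rcases k with _ | k
      · simp
      · simp; ring
    rw [h, bcB_add, ih (fun s => f (s + 1))]
    rcases n with _ | n
    · simp
    · simp only [Nat.add_sub_cancel]
      rw [bcB_succ b c n f]
      push_cast; ring

theorem bcB_split (b c : ℝ) (N : ℕ) (f : ℕ → ℕ → ℝ) :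
    bcB b c N (fun k => ∑ α ∈ Finset.range k, f α (k - 1 - α)) =
      c * ∑ ζ ∈ Finset.range N, bcB b c ζ (fun x => bcB b c (N - 1 - ζ) (f x)) := by
  induction N generalizing f with
  | zero => simp [bcB_zero]
  | succ N ih =>
    rw [bcB_succ, ih]
    have h : (fun k : ℕ => ∑ α ∈ Finset.range (k + 1), f α (k + 1 - 1 - α)) =
        fun k : ℕ => (∑ α ∈ Finset.range k, (fun x y => f x (y + 1)) α (k - 1 - α)) + f k 0 := by
      funext k
      rw [Finset.sum_range_succ]
      congr 1
      · refine Finset.sum_congr rfl fun α hα => ?_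
        have : k + 1 - 1 - α = k - 1 - α + 1 := by simp at hα; omega
        simp only [this]
      · simp
    rw [h, bcB_add, ih (fun x y => f x (y + 1)), Finset.sum_range_succ]
    have h3 : ∑ ζ ∈ Finset.range N, bcB b c ζ (fun x => bcB b c (N + 1 - 1 - ζ) (f x)) =
        b * ∑ ζ ∈ Finset.range N, bcB b c ζ (fun x => bcB b c (N - 1 - ζ) (f x)) +
        c * ∑ ζ ∈ Finset.range N, bcB b c ζ
          (fun x => bcB b c (N - 1 - ζ) (fun y => f x (y + 1))) := by
      rw [Finset.mul_sum, Finset.mul_sum, ← Finset.sum_add_distrib]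
      refine Finset.sum_congr rfl fun ζ hζ => ?_
      have : N + 1 - 1 - ζ = N - 1 - ζ + 1 := by simp at hζ; omega
      rw [this]
      simp only [bcB_succ, bcB_add, bcB_smul]
    rw [h3]
    simp only [Nat.add_sub_cancel, Nat.sub_self, bcB_zero]
    ring

section
variable {ι : Type} [Fintype ι] [DecidableEq ι]

theorem bcT_add (b c : ℝ) (n : ι → ℕ) (f h : (ι → ℕ) → ℝ) :
    bcT b c n (fun k => f k + h k) = bcT b c n f + bcT b c n h := by
  simp [bcT, mul_add, Finset.sum_add_distrib]

theorem bcT_smul (b c : ℝ) (n : ι → ℕ) (a : ℝ) (f : (ι → ℕ) → ℝ) :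
    bcT b c n (fun k => a * f k) = a * bcT b c n f := by
  simp only [bcT, Finset.mul_sum]
  exact Finset.sum_congr rfl fun _ _ => by ring

theorem bcT_sum (b c : ℝ) {κ : Type} (n : ι → ℕ) (s : Finset κ) (f : κ → (ι → ℕ) → ℝ) :
    bcT b c n (fun k => ∑ x ∈ s, f x k) = ∑ x ∈ s, bcT b c n (f x) := by
  simp only [bcT, Finset.mul_sum]
  exact Finset.sum_comm
end

theorem bcT_insertNth (b c : ℝ) {m : ℕ} (p : Fin (m + 1)) (n : Fin (m + 1) → ℕ)
    (F : (Fin (m + 1) → ℕ) → ℝ) :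
    bcT b c n F = bcB b c (n p)
      (fun k => bcT b c (p.removeNth n) (fun ν => F (p.insertNth k ν))) := by
  unfold bcT bcB
  simp only [Finset.mul_sum]
  rw [← Finset.sum_product']
  refine Finset.sum_nbij' (fun μ => (μ p, p.removeNth μ))
    (fun x => p.insertNth x.1 x.2) ?_ ?_ ?_ ?_ ?_
  · intro μ hμ
    rw [Fintype.mem_piFinset] at hμ
    rw [Finset.mem_product, Fintype.mem_piFinset]
    exact ⟨hμ p, fun i => hμ _⟩
  · intro x hx
    rw [Finset.mem_product, Fintype.mem_piFinset] at hx
    rw [Fintype.mem_piFinset, Fin.forall_iff_succAbove p]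
    simpa [Fin.removeNth] using hx
  · intro μ _; simp
  · intro x _; simp
  · intro μ _
    simp only [Fin.insertNth_self_removeNth]
    rw [Fin.prod_univ_succAbove _ p]
    simp only [Fin.removeNth]
    ring

theorem bcT_cons (b c : ℝ) {m : ℕ} (n₀ : ℕ) (n : Fin m → ℕ) (F : (Fin (m + 1) → ℕ) → ℝ) :
    bcT b c (Fin.cons n₀ n : Fin (m + 1) → ℕ) F =
      bcB b c n₀ (fun k => bcT b c n (fun ν => F (Fin.cons k ν))) := by
  rw [bcT_insertNth b c 0]
  simp [Fin.removeNth_zero, Fin.insertNth_zero']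

theorem bcT_sum_type (b c : ℝ) {ι κ l : Type} [Fintype ι] [DecidableEq ι] [Fintype κ]
    [DecidableEq κ] [Fintype l] [DecidableEq l] (e : ι ⊕ κ ≃ l) (n : l → ℕ)
    (F : (ι → ℕ) → ℝ) (G : (κ → ℕ) → ℝ) :
    bcT b c n (fun μ => F (fun i => μ (e (Sum.inl i))) * G (fun i => μ (e (Sum.inr i)))) =
      bcT b c (fun i => n (e (Sum.inl i))) F * bcT b c (fun i => n (e (Sum.inr i))) G := by
  unfold bcT
  rw [Finset.sum_mul_sum, ← Finset.sum_product']
  refine Finset.sum_nbij' (fun μ => (fun i => μ (e (Sum.inl i)), fun i => μ (e (Sum.inr i))))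
    (fun x i => Sum.elim x.1 x.2 (e.symm i)) ?_ ?_ ?_ ?_ ?_
  · intro μ hμ
    rw [Fintype.mem_piFinset] at hμ
    rw [Finset.mem_product, Fintype.mem_piFinset, Fintype.mem_piFinset]
    exact ⟨fun i => hμ _, fun i => hμ _⟩
  · intro x hx
    rw [Finset.mem_product, Fintype.mem_piFinset, Fintype.mem_piFinset] at hx
    rw [Fintype.mem_piFinset]
    intro i
    obtain ⟨y, rfl⟩ := e.surjective i
    rcases y with y | y
    · simpa using hx.1 y
    · simpa using hx.2 y
  · intro μ _
    funext i
    obtain ⟨y, rfl⟩ := e.surjective i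
    rcases y with y | y <;> simp
  · intro x _; simp
  · intro μ _
    rw [← e.prod_comp, Fintype.prod_sum_type]
    ring

/-- The decomposition of indices into `I` and its complement, in increasing order. -/
noncomputable def bcSplitEquiv {m : ℕ} (I : Finset (Fin m)) :
    Fin I.card ⊕ Fin Iᶜ.card ≃ Fin m :=
  Equiv.ofBijective (Sum.elim (I.orderEmbOfFin rfl) (Iᶜ.orderEmbOfFin rfl)) <| by
    rw [Fintype.bijective_iff_injective_and_card]
    constructor
    · refine Function.Injective.sumElim (I.orderEmbOfFin rfl).injective
        (Iᶜ.orderEmbOfFin rfl).injective ?_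
      intro x y h
      have h1 := I.orderEmbOfFin_mem rfl x
      have h2 := Iᶜ.orderEmbOfFin_mem rfl y
      rw [← h] at h2
      exact (Finset.mem_compl.1 h2) h1
    · simp only [Fintype.card_sum, Fintype.card_fin]
      rw [Finset.card_add_card_compl, Fintype.card_fin]

theorem bcT_subvec (b c : ℝ) {m : ℕ} (I : Finset (Fin m)) (n : Fin m → ℕ)
    (F : (Fin I.card → ℕ) → ℝ) (G : (Fin Iᶜ.card → ℕ) → ℝ) :
    bcT b c n (fun μ => F (subvec μ I) * G (subvec μ Iᶜ)) =
      bcT b c (subvec n I) F * bcT b c (subvec n Iᶜ) G :=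
  bcT_sum_type b c (bcSplitEquiv I) n F G

theorem deleteAt_eq {m : ℕ} (j : Fin (m + 1)) (f : Fin (m + 1) → ℕ) :
    (deleteAt j f : Fin m → ℕ) = j.removeNth f := by
  funext i
  unfold deleteAt Fin.removeNth Fin.succAbove
  by_cases h : (i : ℕ) < j
  · have h' : i.castSucc < j := h
    rw [dif_pos h, if_pos h']; rfl
  · have h' : ¬ i.castSucc < j := h
    rw [dif_neg h, if_neg h']; rfl

theorem bc_edge_term (b c : ℝ) {m : ℕ} (j : Fin m) (n : Fin m → ℕ) (N : ℕ)
    (F : (Fin (m - 1 + 1) → ℕ) → ℝ) :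
    bcB b c N (fun k => bcT b c n (fun μ => (μ j : ℝ) *
        F (Fin.cons (k + 1 + μ j - 2) (deleteAt j μ)))) =
      c * ((n j : ℝ) * bcT b c (Fin.cons (N + 1 + n j - 2) (deleteAt j n)) F) := by
  rcases m with _ | m
  · exact j.elim0
  change bcB b c N (fun k => bcT b c n (fun μ => (μ j : ℝ) *
        F (Fin.cons (k + 1 + μ j - 2) (deleteAt j μ : Fin m → ℕ)))) =
      c * ((n j : ℝ) * bcT b c (Fin.cons (N + 1 + n j - 2) (deleteAt j n : Fin m → ℕ) :
        Fin (m + 1) → ℕ) F)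
  rw [bcT_cons]
  simp only [deleteAt_eq]
  have h : ∀ k : ℕ, bcT b c n (fun μ => (μ j : ℝ) *
        F (Fin.cons (k + 1 + μ j - 2) (j.removeNth μ : Fin m → ℕ))) =
      n j * c * bcB b c (n j - 1) (fun l => bcT b c (j.removeNth n : Fin m → ℕ)
        (fun ν => F (Fin.cons (k + l) ν))) := by
    intro k
    rw [bcT_insertNth b c j, ← bcB_deriv b c (n j)
      (fun l => bcT b c (j.removeNth n : Fin m → ℕ) (fun ν => F (Fin.cons (k + l) ν)))]
    congr 1
    funext l
    simp only [Fin.insertNth_apply_same, Fin.removeNth_insertNth]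
    rw [bcT_smul]
    rcases l with _ | l
    · simp
    · rw [show k + 1 + (l + 1) - 2 = k + (l + 1 - 1) by omega]
  simp only [h]
  rw [bcB_smul, bcB_vandermonde b c N (n j - 1)
    (fun s => bcT b c (j.removeNth n : Fin m → ℕ) (fun ν => F (Fin.cons s ν)))]
  rcases Nat.eq_zero_or_pos (n j) with h0 | h0
  · simp [h0]
  · rw [show N + 1 + n j - 2 = N + (n j - 1) by omega]
    ring

theorem bcB_congr (b c : ℝ) (n : ℕ) {f h : ℕ → ℝ} (e : ∀ k, f k = h k) :
    bcB b c n f = bcB b c n h := by rw [funext e]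

/-- If the family `C` satisfies the generalized Catalan recursion (with the sum
over `α + β = μ₁ − 2` ranging over nonnegative integers, genus `−1` terms
interpreted as `0`, and the last sum over all decompositions `g₁ + g₂ = g` and
all ordered set partitions `I ⊔ J` of the remaining indices), then the
generalized `bc`-Motzkin numbers `M̃` built from `C` satisfy the analogous
recursion. Vectors of length `v = m + 1` are written `Fin.cons n₀ n` with `n₀`
the first entry. -/
theorem bcMotzkin_generalized_recursion (b c : ℝ)
    (C : ℕ → (v : ℕ) → (Fin v → ℕ) → ℝ)
    (hC : ∀ (g m : ℕ) (μ₀ : ℕ) (μ : Fin m → ℕ), 1 ≤ μ₀ →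
      C g (m + 1) (Fin.cons μ₀ μ) =
        (∑ j : Fin m, (μ j : ℝ) *
            C g (m - 1 + 1) (Fin.cons (μ₀ + μ j - 2) (deleteAt j μ))) +
          ∑ α ∈ Finset.range (μ₀ - 1),
            ((if g = 0 then 0 else
                C (g - 1) (m + 2) (Fin.cons α (Fin.cons (μ₀ - 2 - α) μ))) +
              ∑ g₁ ∈ Finset.range (g + 1), ∑ I : Finset (Fin m),
                C g₁ (I.card + 1) (Fin.cons α (subvec μ I)) *
                  C (g - g₁) (Iᶜ.card + 1) (Fin.cons (μ₀ - 2 - α) (subvec μ Iᶜ))))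
    (g m : ℕ) (n₀ : ℕ) (n : Fin m → ℕ) (hn : 1 ≤ n₀) :
    Mgen b c C g (m + 1) (Fin.cons n₀ n) -
        b * Mgen b c C g (m + 1) (Fin.cons (n₀ - 1) n) =
      c ^ 2 *
        ((∑ j : Fin m, (n j : ℝ) *
            Mgen b c C g (m - 1 + 1) (Fin.cons (n₀ + n j - 2) (deleteAt j n))) +
          ∑ ζ ∈ Finset.range (n₀ - 1),
            ((if g = 0 then 0 else
                Mgen b c C (g - 1) (m + 2) (Fin.cons ζ (Fin.cons (n₀ - 2 - ζ) n))) +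
              ∑ g₁ ∈ Finset.range (g + 1), ∑ I : Finset (Fin m),
                Mgen b c C g₁ (I.card + 1) (Fin.cons ζ (subvec n I)) *
                  Mgen b c C (g - g₁) (Iᶜ.card + 1)
                    (Fin.cons (n₀ - 2 - ζ) (subvec n Iᶜ)))) := by
  obtain ⟨N, rfl⟩ : ∃ N, n₀ = N + 1 := ⟨n₀ - 1, by omega⟩
  simp only [Mgen_eq_bcT, Nat.add_sub_cancel]
  rw [bcT_cons, bcT_cons, bcB_succ, add_sub_cancel_left]
  -- the sum over splittings, as a function of the two arcs
  let Φ : ℕ → ℕ → (Fin m → ℕ) → ℝ := fun α β μ =>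
    (if g = 0 then 0 else C (g - 1) (m + 2) (Fin.cons α (Fin.cons β μ))) +
      ∑ g₁ ∈ Finset.range (g + 1), ∑ I : Finset (Fin m),
        C g₁ (I.card + 1) (Fin.cons α (subvec μ I)) *
          C (g - g₁) (Iᶜ.card + 1) (Fin.cons β (subvec μ Iᶜ))
  have hrec : ∀ k, bcT b c n (fun ν => C g (m + 1) (Fin.cons (k + 1) ν)) =
      (∑ j : Fin m, bcT b c n (fun μ => (μ j : ℝ) *
        C g (m - 1 + 1) (Fin.cons (k + 1 + μ j - 2) (deleteAt j μ)))) +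
      ∑ α ∈ Finset.range k, bcT b c n (Φ α (k - 1 - α)) := by
    intro k
    rw [← bcT_sum, ← bcT_sum, ← bcT_add]
    congr 1
    funext μ
    rw [hC g m (k + 1) μ (by omega), Nat.add_sub_cancel, show k + 1 - 2 = k - 1 by omega]
  rw [bcB_congr b c N hrec, bcB_add, bcB_sum,
    bcB_split b c N (fun α β => bcT b c n (Φ α β))]
  simp only [bc_edge_term]
  rw [← Finset.mul_sum, ← mul_add, ← mul_assoc, ← pow_two]
  congr 2
  refine Finset.sum_congr rfl fun ζ _ => ?_
  rw [show N + 1 - 2 - ζ = N - 1 - ζ by omega]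
  simp only [Φ, bcT_add, bcT_sum, bcB_add, bcB_sum]
  congr 1
  · split_ifs with h0
    · simp [bcT, bcB]
    · rw [bcT_cons]
      simp only [bcT_cons]
  · refine Finset.sum_congr rfl fun g₁ _ => Finset.sum_congr rfl fun I _ => ?_
    rw [bcT_cons, bcT_cons]
    have key : ∀ x y, bcT b c n (fun μ => C g₁ (I.card + 1) (Fin.cons x (subvec μ I)) *
          C (g - g₁) (Iᶜ.card + 1) (Fin.cons y (subvec μ Iᶜ))) =
        bcT b c (subvec n I) (fun ν => C g₁ (I.card + 1) (Fin.cons x ν)) *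
        bcT b c (subvec n Iᶜ) (fun ν => C (g - g₁) (Iᶜ.card + 1) (Fin.cons y ν)) :=
      fun x y => bcT_subvec b c I n (fun ν => C g₁ (I.card + 1) (Fin.cons x ν))
        (fun ν => C (g - g₁) (Iᶜ.card + 1) (Fin.cons y ν))
    simp only [key, bcB_smul]
    rw [mul_comm, ← bcB_smul]
    exact bcB_congr b c ζ fun k => mul_comm _ _
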